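/- For every d ≥ 1 there exists a constant c ∈ (0, 1/5) depending only on d such that for every set 𝖠 ⊆ ℝ^d and every s > 0 there exists an open set 𝖠^{(s)} ⊆ ℝ^d such that (1) 𝖠 ⊆ 𝖠^{(s)} ⊆ 𝖡(𝖠, s/5) and (2) 𝖠^{(s)} is c·s-regular. -/

import Mathlib

noncomputable section

open Set Metric

/-- An open set `D ⊆ ℝ^d` is `s`-regular when every boundary point can be touched from
inside and from outside by closed balls of radius `s` meeting the boundary only there. -/
def SReg (d : ℕ) (s : ℝ) (D : Set (EuclideanSpace ℝ (Fin d))) : Prop :=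
  IsOpen D ∧
  ∀ x ∈ frontier D, ∃ cin cout : EuclideanSpace ℝ (Fin d),
    closedBall cin s ⊆ closure D ∧ closedBall cout s ⊆ Dᶜ ∧
    frontier D ∩ closedBall cin s = {x} ∧ frontier D ∩ closedBall cout s = {x}

open MeasureTheory


theorem sreg_touch {E : Type*} [NormedAddCommGroup E] [InnerProductSpace ℝ E] (g : E → ℝ)
    (x p : E) (m a C ρ : ℝ) (hm : m ≤ ‖p‖) (hρ : 0 < ρ) (hρa : 2 * ρ ≤ a)
    (hC : 0 ≤ C) (hCm : C * (2 * ρ) < m)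
    (hT : ∀ h : E, ‖h‖ ≤ a → |g (x + h) - g x - inner ℝ p h| ≤ C * ‖h‖ ^ 2) :
    ∀ y ∈ closedBall (x + (ρ / ‖p‖) • p) ρ, y ≠ x → g x < g y := by
  intro y hy hyx
  have hp : 0 < ‖p‖ := lt_of_lt_of_le (lt_of_le_of_lt (by positivity) hCm) hm
  obtain ⟨h, rfl⟩ : ∃ h, y = x + h := ⟨y - x, by simp⟩
  have hh : 0 < ‖h‖ := by
    rw [norm_pos_iff]; rintro rfl; simp at hyx
  rw [mem_closedBall, dist_eq_norm, add_sub_add_left_eq_sub] at hy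
  have hn : ‖(ρ / ‖p‖) • p‖ = ρ := by
    rw [norm_smul, Real.norm_of_nonneg (by positivity)]; field_simp
  have h1 : ‖h‖ ≤ a := by
    calc ‖h‖ = ‖(h - (ρ / ‖p‖) • p) + (ρ / ‖p‖) • p‖ := by simp
      _ ≤ ρ + ρ := (norm_add_le _ _).trans (by rw [hn]; linarith)
      _ ≤ a := by linarith
  have h2 : ‖h - (ρ / ‖p‖) • p‖ ^ 2 ≤ ρ ^ 2 := by gcongr
  rw [norm_sub_sq_real, hn, inner_smul_right, real_inner_comm] at h2
  have h3 : ‖p‖ * ‖h‖ ^ 2 ≤ 2 * ρ * inner ℝ p h := by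
    have : ‖h‖ ^ 2 ≤ 2 * (ρ / ‖p‖ * inner ℝ p h) := by linarith
    calc ‖p‖ * ‖h‖ ^ 2 ≤ ‖p‖ * (2 * (ρ / ‖p‖ * inner ℝ p h)) := by gcongr
      _ = _ := by field_simp
  have h4 := (abs_le.1 (hT h h1)).1
  have h5 : C * (2 * ρ) * ‖h‖ ^ 2 < ‖p‖ * ‖h‖ ^ 2 := by
    apply mul_lt_mul_of_pos_right (by linarith) (by positivity)
  have h6 : C * ‖h‖ ^ 2 < inner ℝ p h := by
    have : (2 * ρ) * (C * ‖h‖ ^ 2) < (2 * ρ) * inner ℝ p h := by linarith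
    exact lt_of_mul_lt_mul_left this (by positivity)
  linarith

/-- coordinatewise floor along the diagonal line through `x`. -/
def nfl {d : ℕ} (x : EuclideanSpace ℝ (Fin d)) (t : ℝ) : Fin d → ℤ := fun i => ⌊x i + t⌋

/-- Freudenthal interpolation. -/
def ffl {d : ℕ} (F : (Fin d → ℤ) → ℝ) (x : EuclideanSpace ℝ (Fin d)) : ℝ :=
  ∫ t in (0:ℝ)..1, F (nfl x t)

variable {d : ℕ}

theorem meas_nfl2 (F : (Fin d → ℤ) → ℝ) :
    Measurable (fun q : EuclideanSpace ℝ (Fin d) × ℝ => F (nfl q.1 q.2)) := by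
  have hF : Measurable F := measurable_of_countable F
  refine hF.comp (measurable_pi_lambda _ fun i => ?_)
  exact Int.measurable_floor.comp (by fun_prop)

theorem meas_nfl (F : (Fin d → ℤ) → ℝ) (x : EuclideanSpace ℝ (Fin d)) :
    Measurable (fun t : ℝ => F (nfl x t)) :=
  (meas_nfl2 F).comp (measurable_const.prodMk measurable_id)

theorem ii_nfl (F : (Fin d → ℤ) → ℝ) (hF : ∀ v, F v = 0 ∨ F v = 1)
    (x : EuclideanSpace ℝ (Fin d)) (a b : ℝ) :
    IntervalIntegrable (fun t : ℝ => F (nfl x t)) volume a b := by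
  rw [intervalIntegrable_iff]
  refine Measure.integrableOn_of_bounded (M := 1) (by simp) (meas_nfl F x).aestronglyMeasurable ?_
  refine Filter.Eventually.of_forall fun t => ?_
  rcases hF (nfl x t) with h | h <;> simp [h]

theorem meas_ffl (F : (Fin d → ℤ) → ℝ) : Measurable (ffl F) := by
  unfold ffl
  simp only [intervalIntegral.integral_of_le zero_le_one]
  exact (StronglyMeasurable.integral_prod_right (ν := volume.restrict (Ioc (0:ℝ) 1))
    (meas_nfl2 F).stronglyMeasurable).measurable

theorem ffl_nonneg (F : (Fin d → ℤ) → ℝ) (hF : ∀ v, F v = 0 ∨ F v = 1) (x) : 0 ≤ ffl F x := by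
  apply intervalIntegral.integral_nonneg zero_le_one
  intro t _
  rcases hF (nfl x t) with h | h <;> simp [h]

theorem ffl_le_one (F : (Fin d → ℤ) → ℝ) (hF : ∀ v, F v = 0 ∨ F v = 1) (x) : ffl F x ≤ 1 := by
  have : ffl F x ≤ ∫ t in (0:ℝ)..1, (1:ℝ) := by
    apply intervalIntegral.integral_mono_on zero_le_one (ii_nfl F hF x 0 1) (by simp)
    intro t _
    rcases hF (nfl x t) with h | h <;> simp [h]
  simpa using this

theorem ffl_const (F : (Fin d → ℤ) → ℝ) (x) (q : ℝ)
    (h : ∀ t ∈ Icc (0:ℝ) 1, F (nfl x t) = q) : ffl F x = q := by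
  unfold ffl
  rw [intervalIntegral.integral_congr (g := fun _ => q)]
  · simp
  · intro t ht
    rw [uIcc_of_le zero_le_one] at ht
    exact h t ht

theorem ffl_shift (F : (Fin d → ℤ) → ℝ) (hF : ∀ v, F v = 0 ∨ F v = 1)
    (x : EuclideanSpace ℝ (Fin d)) (b c t : ℝ) (v w : Fin d → ℤ)
    (hb : 0 ≤ b) (ht : 0 ≤ t) (hbc : b + t ≤ c) (hc : c + t ≤ 1)
    (hv : ∀ τ ∈ Icc b (b + t), nfl x τ = v) (hw : ∀ τ ∈ Icc c (c + t), nfl x τ = w) :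
    ffl F (x + t • WithLp.toLp 2 (fun i => ((w i - v i : ℤ) : ℝ))) = ffl F x + t * (F w - F v) := by
  set u : EuclideanSpace ℝ (Fin d) := WithLp.toLp 2 (fun i => ((w i - v i : ℤ) : ℝ)) with hu
  have v0 : ∀ i, ⌊x i + b⌋ = v i := fun i => congrFun (hv b ⟨le_rfl, by linarith⟩) i
  have v1 : ∀ i, ⌊x i + (b + t)⌋ = v i := fun i => congrFun (hv (b + t) ⟨by linarith, by linarith⟩) i
  have w0 : ∀ i, ⌊x i + c⌋ = w i := fun i => congrFun (hw c ⟨le_rfl, by linarith⟩) i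
  have w1 : ∀ i, ⌊x i + (c + t)⌋ = w i := fun i => congrFun (hw (c + t) ⟨by linarith, by linarith⟩) i
  have hui : ∀ i, (x + t • u) i = x i + t * ((w i : ℝ) - v i) := by
    intro i; simp [hu]
  have huc : ∀ i, w i = v i ∨ w i = v i + 1 := by
    intro i
    have h1 : v i ≤ w i := by
      rw [← v0, ← w0]; exact Int.floor_le_floor (by linarith)
    have h2 : w i ≤ v i + 1 := by
      rw [← v0, ← w0, ← Int.floor_add_one]; exact Int.floor_le_floor (by linarith)
    omega
  have e1 : ∀ τ ∈ Icc 0 b, nfl (x + t • u) τ = nfl x τ := by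
    rintro τ ⟨h0, h1⟩
    funext i
    simp only [nfl, hui]
    rcases huc i with h | h
    · simp [h]
    · have hlow : v i ≤ ⌊x i + τ⌋ := by
        have : w i ≤ ⌊x i + τ⌋ + 1 := by
          rw [← w0, ← Int.floor_add_one]; exact Int.floor_le_floor (by linarith)
        omega
      have hup : ⌊x i + t + τ⌋ ≤ v i := by
        rw [← v1]; exact Int.floor_le_floor (by linarith)
      have hmid : ⌊x i + τ⌋ ≤ ⌊x i + t + τ⌋ := Int.floor_le_floor (by linarith)
      have : x i + t * ((w i : ℝ) - v i) + τ = x i + t + τ := by rw [h]; push_cast; ring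
      rw [this]; omega
  have e2 : ∀ τ ∈ Icc b c, nfl (x + t • u) τ = nfl x (τ + t) := by
    rintro τ ⟨h0, h1⟩
    funext i
    simp only [nfl, hui]
    rcases huc i with h | h
    · have hlow : v i ≤ ⌊x i + τ⌋ := by
        rw [← v0]; exact Int.floor_le_floor (by linarith)
      have hup : ⌊x i + (τ + t)⌋ ≤ w i := by
        rw [← w1]; exact Int.floor_le_floor (by linarith)
      have hmid : ⌊x i + τ⌋ ≤ ⌊x i + (τ + t)⌋ := Int.floor_le_floor (by linarith)
      have : x i + t * ((w i : ℝ) - v i) + τ = x i + τ := by rw [h]; ring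
      rw [this]; omega
    · congr 1; rw [h]; push_cast; ring
  have e3 : ∀ τ ∈ Icc c 1, nfl (x + t • u) τ = nfl x τ := by
    rintro τ ⟨h0, h1⟩
    funext i
    simp only [nfl, hui]
    rcases huc i with h | h
    · simp [h]
    · have hlow : w i ≤ ⌊x i + τ⌋ := by
        rw [← w0]; exact Int.floor_le_floor (by linarith)
      have hup : ⌊x i + t + τ⌋ ≤ v i + 1 := by
        rw [← v1, ← Int.floor_add_one]; exact Int.floor_le_floor (by linarith)
      have hmid : ⌊x i + τ⌋ ≤ ⌊x i + t + τ⌋ := Int.floor_le_floor (by linarith)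
      have : x i + t * ((w i : ℝ) - v i) + τ = x i + t + τ := by rw [h]; push_cast; ring
      rw [this]; omega
  have I := ii_nfl F hF x
  have I' := ii_nfl F hF (x + t • u)
  have s1 : ffl F (x + t • u) = (∫ τ in (0:ℝ)..b, F (nfl x τ)) + (∫ τ in b..c, F (nfl x (τ + t)))
      + ∫ τ in c..1, F (nfl x τ) := by
    unfold ffl
    rw [← intervalIntegral.integral_add_adjacent_intervals (I' 0 c) (I' c 1),
      ← intervalIntegral.integral_add_adjacent_intervals (I' 0 b) (I' b c)]
    congr 1
    · congr 1
      · apply intervalIntegral.integral_congr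
        intro τ hτ
        rw [uIcc_of_le hb] at hτ
        simp only [e1 τ hτ]
      · apply intervalIntegral.integral_congr
        intro τ hτ
        rw [uIcc_of_le (by linarith)] at hτ
        simp only [e2 τ hτ]
    · apply intervalIntegral.integral_congr
      intro τ hτ
      rw [uIcc_of_le (by linarith)] at hτ
      simp only [e3 τ hτ]
  rw [intervalIntegral.integral_comp_add_right (fun τ => F (nfl x τ))] at s1
  have s2 : ffl F x = (∫ τ in (0:ℝ)..b, F (nfl x τ)) + (∫ τ in b..c, F (nfl x τ))
      + ∫ τ in c..1, F (nfl x τ) := by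
    unfold ffl
    rw [← intervalIntegral.integral_add_adjacent_intervals (I 0 c) (I c 1),
      ← intervalIntegral.integral_add_adjacent_intervals (I 0 b) (I b c)]
  have s3 := intervalIntegral.integral_add_adjacent_intervals (I b (b + t)) (I (b + t) (c + t))
  have s4 := intervalIntegral.integral_add_adjacent_intervals (I b c) (I c (c + t))
  have s5 : ∫ τ in b..(b + t), F (nfl x τ) = t * F v := by
    rw [intervalIntegral.integral_congr (g := fun _ => F v)]
    · simp
    · intro τ hτ
      rw [uIcc_of_le (by linarith)] at hτ
      simp only [hv τ hτ]
  have s6 : ∫ τ in c..(c + t), F (nfl x τ) = t * F w := by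
    rw [intervalIntegral.integral_congr (g := fun _ => F w)]
    · simp
    · intro τ hτ
      rw [uIcc_of_le (by linarith)] at hτ
      simp only [hw τ hτ]
  rw [s1, s2]
  linarith

/-- The bad times. -/
def badT (x : EuclideanSpace ℝ (Fin d)) (η : ℝ) : Set ℝ :=
  ⋃ i : Fin d, ⋃ j : Fin 3, closedBall ((⌊x i⌋ + (j : ℕ) : ℝ) - x i) η

theorem badT_vol (x : EuclideanSpace ℝ (Fin d)) (η : ℝ) (hη : 0 ≤ η) :
    volume (badT x η) ≤ ENNReal.ofReal (6 * d * η) := by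
  unfold badT
  calc _ ≤ ∑ i : Fin d, ∑ j : Fin 3, volume (closedBall ((⌊x i⌋ + (j : ℕ) : ℝ) - x i) η) :=
        (measure_iUnion_fintype_le _ _).trans
          (Finset.sum_le_sum fun i _ => measure_iUnion_fintype_le _ _)
    _ = ENNReal.ofReal (6 * d * η) := by
      simp only [Real.volume_closedBall, Finset.sum_const, Finset.card_univ, Fintype.card_fin,
        nsmul_eq_mul]
      rw [← ENNReal.ofReal_natCast, ← ENNReal.ofReal_natCast, ← ENNReal.ofReal_mul (by positivity),
        ← ENNReal.ofReal_mul (by positivity)]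
      congr 1; push_cast; ring

theorem badT_floor (x y : EuclideanSpace ℝ (Fin d)) (η t τ : ℝ) (hη : η < 1)
    (ht : t ∈ Ioo (0:ℝ) 1) (hT : t ∉ badT x η) (hy : ∀ i, |y i + τ - (x i + t)| ≤ η) :
    nfl y τ = nfl x t := by
  funext i
  have key : ∀ k : ℤ, η < |x i + t - k| := by
    intro k
    by_contra hk
    push Not at hk
    obtain ⟨h1, h2⟩ := abs_le.1 hk
    have f1 := Int.floor_le (x i)
    have f2 := Int.lt_floor_add_one (x i)
    obtain ⟨ht0, ht1⟩ := ht
    have k1 : ⌊x i⌋ - 1 < k := by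
      have : ((⌊x i⌋ - 1 : ℤ) : ℝ) < k := by push_cast; linarith
      exact_mod_cast this
    have k2 : k < ⌊x i⌋ + 3 := by
      have : (k : ℝ) < ((⌊x i⌋ + 3 : ℤ) : ℝ) := by push_cast; linarith
      exact_mod_cast this
    apply hT
    have hj : (k - ⌊x i⌋).toNat < 3 := by omega
    refine mem_iUnion.2 ⟨i, mem_iUnion.2 ⟨⟨(k - ⌊x i⌋).toNat, hj⟩, ?_⟩⟩
    have hk' : ((⌊x i⌋ : ℝ) + ((k - ⌊x i⌋).toNat : ℝ)) = k := by
      have : ⌊x i⌋ + ((k - ⌊x i⌋).toNat : ℤ) = k := by omega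
      exact_mod_cast this
    rw [mem_closedBall, Real.dist_eq]
    simp only [hk']
    rw [show t - (k - x i) = x i + t - k by ring]; exact hk
  simp only [nfl]
  obtain ⟨h1, h2⟩ := abs_le.1 (hy i)
  have a1 := Int.floor_le (x i + t)
  have a2 := Int.lt_floor_add_one (x i + t)
  have k1 := key ⌊x i + t⌋
  have k2 := key (⌊x i + t⌋ + 1)
  rw [abs_of_nonneg (by linarith)] at k1
  push_cast at k2
  rw [abs_of_neg (by linarith)] at k2
  rw [Int.floor_eq_iff]
  constructor <;> linarith

theorem ffl_near (F : (Fin d → ℤ) → ℝ) (hF : ∀ v, F v = 0 ∨ F v = 1)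
    (x y : EuclideanSpace ℝ (Fin d)) (η q : ℝ) (hq : q = 0 ∨ q = 1) (hη : η < 1) (hη0 : 0 ≤ η)
    (h : ∀ t ∈ Ioo (0:ℝ) 1, t ∉ badT x η → F (nfl x t) = q)
    (hy : ∀ i, |y i - x i| ≤ η) : |ffl F y - q| ≤ 6 * d * η := by
  have hm : MeasurableSet (badT x η) :=
    MeasurableSet.iUnion fun i => MeasurableSet.iUnion fun j => measurableSet_closedBall
  have hfin : volume (badT x η) < ⊤ := (badT_vol x η hη0).trans_lt ENNReal.ofReal_lt_top
  have e : ffl F y - q = ∫ t in Ioo (0:ℝ) 1, (F (nfl y t) - q) := by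
    rw [← integral_Ioc_eq_integral_Ioo, ← intervalIntegral.integral_of_le zero_le_one,
      intervalIntegral.integral_sub (ii_nfl F hF y 0 1) (by simp)]
    simp [ffl]
  rw [e, ← Real.norm_eq_abs]
  calc _ ≤ ∫ t in Ioo (0:ℝ) 1, (badT x η).indicator (fun _ => (1:ℝ)) t := by
        apply norm_integral_le_of_norm_le
        · exact ((integrable_indicator_iff hm).2 (by simp [integrableOn_const_iff, hfin])).integrableOn
        · filter_upwards [ae_restrict_mem measurableSet_Ioo] with t ht
          by_cases hb : t ∈ badT x η
          · rw [indicator_of_mem hb, Real.norm_eq_abs]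
            rcases hF (nfl y t) with h1 | h1 <;> rcases hq with h2 | h2 <;> simp [h1, h2]
          · rw [indicator_of_notMem hb, badT_floor x y η t t hη ht hb (by simpa using hy),
              h t ht hb]
            simp
    _ ≤ ∫ t, (badT x η).indicator (fun _ => (1:ℝ)) t := by
        apply setIntegral_le_integral
        · exact ((integrable_indicator_iff hm).2 (by simp [integrableOn_const_iff, hfin]))
        · exact Filter.Eventually.of_forall fun t => indicator_nonneg (by simp) t
    _ = volume.real (badT x η) := by rw [integral_indicator hm]; simp
    _ ≤ 6 * d * η := ENNReal.toReal_le_of_le_ofReal (by positivity) (badT_vol x η hη0)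

theorem phi_exists (d : ℕ) (r : ℝ) (hr : 0 < r) (hr1 : r ≤ 1) :
    ∃ φ : EuclideanSpace ℝ (Fin d) → ℝ, Continuous φ ∧ (∀ y, 0 ≤ φ y) ∧ (∫ y, φ y = 1) ∧
      Integrable φ ∧
      (∀ y, r < ‖y‖ → φ y = 0) ∧ ∃ (Dφ : EuclideanSpace ℝ (Fin d) → EuclideanSpace ℝ (Fin d) →L[ℝ] ℝ)
        (L : ℝ), 0 ≤ L ∧ Continuous Dφ ∧ Integrable Dφ ∧
        (∀ z h, ‖h‖ ≤ 1 → |φ (z + h) - φ z - Dφ z h| ≤ L * ‖h‖ ^ 2) ∧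
        (∀ z h, ‖h‖ ≤ 1 → 2 < ‖z‖ → φ (z + h) - φ z - Dφ z h = 0) := by
  let B : ContDiffBump (0 : EuclideanSpace ℝ (Fin d)) := ⟨r / 2, r, by positivity, by linarith⟩
  let φ := B.normed volume
  have hcd : ContDiff ℝ 2 φ := B.contDiff_normed
  have hcs : HasCompactSupport φ := B.hasCompactSupport_normed
  have hD : ContDiff ℝ 1 (fderiv ℝ φ) := hcd.fderiv_right (by norm_num)
  have hDs : HasCompactSupport (fderiv ℝ φ) := hcs.fderiv ℝ
  obtain ⟨K, hK⟩ := hD.lipschitzWith_of_hasCompactSupport hDs (by norm_num)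
  have hts : tsupport φ = closedBall 0 r := B.tsupport_normed_eq
  have hz : ∀ y, r < ‖y‖ → φ y = 0 := by
    intro y hy
    apply image_eq_zero_of_notMem_tsupport
    rw [hts]; simpa using hy
  refine ⟨φ, hcd.continuous, B.nonneg_normed, B.integral_normed, 
    hcd.continuous.integrable_of_hasCompactSupport hcs, hz, fderiv ℝ φ, K, K.2, hD.continuous,
    hD.continuous.integrable_of_hasCompactSupport hDs, ?_, ?_⟩
  · intro z h _
    have := (convex_closedBall z ‖h‖).norm_image_sub_le_of_norm_hasFDerivWithin_le'
      (f := φ) (f' := fderiv ℝ φ) (φ := fderiv ℝ φ z) (C := K * ‖h‖) (x := z) (y := z + h)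
      (fun w _ => ((hcd.differentiable (by norm_num)) w).hasFDerivAt.hasFDerivWithinAt)
      (fun w hw => by
        rw [← dist_eq_norm]
        exact (hK.dist_le_mul w z).trans (by gcongr; exact hw))
      (by simp) (by simp)
    rw [Real.norm_eq_abs] at this
    simp only [add_sub_cancel_left] at this
    linarith
  · intro z h hh hz2
    rw [hz z (by linarith), hz (z + h)]
    · have : fderiv ℝ φ z = 0 := by
        by_contra hne
        have := (support_fderiv_subset ℝ (f := φ)) (Function.mem_support.2 hne)
        rw [hts] at this
        simp at this
        linarith
      simp [this]
    · have : ‖z‖ ≤ ‖z + h‖ + ‖h‖ := by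
        simpa using norm_sub_le (z + h) h
      linarith

/-- mollified interpolation -/
def gfl (F : (Fin d → ℤ) → ℝ) (φ : EuclideanSpace ℝ (Fin d) → ℝ) (x : EuclideanSpace ℝ (Fin d)) : ℝ :=
  ∫ y, ffl F y * φ (x - y)

theorem gfl_eq (F : (Fin d → ℤ) → ℝ) (φ : EuclideanSpace ℝ (Fin d) → ℝ) (x) :
    gfl F φ x = ∫ y, ffl F (x - y) * φ y := by
  rw [← integral_sub_left_eq_self (fun y => ffl F (x - y) * φ y) volume x]
  simp [gfl]

theorem ffl_mul_int (F : (Fin d → ℤ) → ℝ) (hF : ∀ v, F v = 0 ∨ F v = 1)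
    {G : Type*} [NormedAddCommGroup G] [NormedSpace ℝ G]
    (ψ : EuclideanSpace ℝ (Fin d) → G) (hψ : Integrable ψ) (x) :
    Integrable (fun y => ffl F (x - y) • ψ y) := by
  refine hψ.bdd_smul (C := 1) ?_ ?_
  · exact ((meas_ffl F).comp (by fun_prop)).aestronglyMeasurable
  · refine Filter.Eventually.of_forall fun y => ?_
    rw [Real.norm_of_nonneg (ffl_nonneg F hF _)]
    exact ffl_le_one F hF _

theorem ffl_mul_int' (F : (Fin d → ℤ) → ℝ) (hF : ∀ v, F v = 0 ∨ F v = 1)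
    {G : Type*} [NormedAddCommGroup G] [NormedSpace ℝ G]
    (ψ : EuclideanSpace ℝ (Fin d) → G) (hψ : Integrable ψ) (x) :
    Integrable (fun y => ffl F y • ψ (x - y)) := by
  have := (ffl_mul_int F hF ψ hψ x).comp_sub_left x
  simpa using this

/-- averaging principle -/
theorem gfl_avg (F : (Fin d → ℤ) → ℝ) (hF : ∀ v, F v = 0 ∨ F v = 1)
    (φ : EuclideanSpace ℝ (Fin d) → ℝ) (h0 : ∀ y, 0 ≤ φ y) (h1 : ∫ y, φ y = 1) (hI : Integrable φ)
    (r : ℝ) (hr : ∀ y, r < ‖y‖ → φ y = 0) (x) (q δ : ℝ)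
    (h : ∀ y, ‖y‖ ≤ r → |ffl F (x - y) - q| ≤ δ) : |gfl F φ x - q| ≤ δ := by
  have e : gfl F φ x - q = ∫ y, (ffl F (x - y) - q) * φ y := by
    simp only [sub_mul]
    rw [integral_sub (by simpa using ffl_mul_int F hF φ hI x) (hI.const_mul q), integral_const_mul, h1, gfl_eq]
    simp
  rw [e, ← Real.norm_eq_abs]
  calc _ ≤ ∫ y, δ * φ y := by
        apply norm_integral_le_of_norm_le (hI.const_mul δ)
        refine Filter.Eventually.of_forall fun y => ?_
        rw [norm_mul, Real.norm_of_nonneg (h0 y), Real.norm_eq_abs]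
        by_cases hy : ‖y‖ ≤ r
        · exact mul_le_mul_of_nonneg_right (h y hy) (h0 y)
        · simp [hr y (not_le.1 hy)]
    _ = δ := by rw [integral_const_mul, h1, mul_one]

theorem gfl_taylor (F : (Fin d → ℤ) → ℝ) (hF : ∀ v, F v = 0 ∨ F v = 1)
    (φ : EuclideanSpace ℝ (Fin d) → ℝ) (hI : Integrable φ)
    (Dφ : EuclideanSpace ℝ (Fin d) → EuclideanSpace ℝ (Fin d) →L[ℝ] ℝ)
    (L : ℝ) (hL : 0 ≤ L) (hDI : Integrable Dφ)
    (hT : ∀ z h, ‖h‖ ≤ 1 → |φ (z + h) - φ z - Dφ z h| ≤ L * ‖h‖ ^ 2)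
    (hT0 : ∀ z h, ‖h‖ ≤ 1 → 2 < ‖z‖ → φ (z + h) - φ z - Dφ z h = 0) (x : EuclideanSpace ℝ (Fin d)) :
    ∃ p : EuclideanSpace ℝ (Fin d), ∀ h, ‖h‖ ≤ 1 →
      |gfl F φ (x + h) - gfl F φ x - inner ℝ p h| ≤
        (L * volume.real (closedBall (0 : EuclideanSpace ℝ (Fin d)) 2)) * ‖h‖ ^ 2 := by
  let P : EuclideanSpace ℝ (Fin d) →L[ℝ] ℝ := ∫ y, ffl F y • Dφ (x - y)
  refine ⟨(InnerProductSpace.toDual ℝ _).symm P, fun h hh => ?_⟩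
  rw [InnerProductSpace.toDual_symm_apply]
  have hP : P h = ∫ y, ffl F y * Dφ (x - y) h := by
    simp only [P]
    rw [ContinuousLinearMap.integral_apply (ffl_mul_int' F hF Dφ hDI x)]
    simp
  have i1 := ffl_mul_int' F hF φ hI (x + h)
  have i2 := ffl_mul_int' F hF φ hI x
  have i3 := (ffl_mul_int' F hF Dφ hDI x).apply_continuousLinearMap h
  have e : gfl F φ (x + h) - gfl F φ x - P h =
      ∫ y, ffl F y * (φ ((x - y) + h) - φ (x - y) - Dφ (x - y) h) := by
    rw [hP, gfl, gfl]
    rw [← integral_sub (by simpa using i1) (by simpa using i2), ← integral_sub]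
    · congr 1; funext y
      rw [show x + h - y = x - y + h by abel]; ring
    · exact i1.sub i2
    · simpa using i3
  have e2 : ∫ y, ffl F y * (φ ((x - y) + h) - φ (x - y) - Dφ (x - y) h) =
      ∫ y in closedBall x 2, ffl F y * (φ ((x - y) + h) - φ (x - y) - Dφ (x - y) h) := by
    symm
    apply setIntegral_eq_integral_of_forall_compl_eq_zero
    intro y hy
    rw [hT0 (x - y) h hh, mul_zero]
    rw [← dist_eq_norm, dist_comm]; simpa using hy
  rw [e, e2, ← Real.norm_eq_abs]
  have hvol : volume.real (closedBall x 2) = volume.real (closedBall (0 : EuclideanSpace ℝ (Fin d)) 2) := by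
    simp only [Measure.real]
    rw [Measure.addHaar_closedBall_center]
  rw [← hvol]
  refine (norm_setIntegral_le_of_norm_le_const (C := L * ‖h‖ ^ 2) measure_closedBall_lt_top ?_).trans
    (le_of_eq (by ring))
  intro y _
  rw [norm_mul, Real.norm_of_nonneg (ffl_nonneg F hF y), Real.norm_eq_abs]
  calc _ ≤ 1 * (L * ‖h‖ ^ 2) := by
        gcongr
        · exact ffl_le_one F hF y
        · exact hT _ _ hh
    _ = _ := one_mul _

theorem taylor_cont {E : Type*} [NormedAddCommGroup E] [InnerProductSpace ℝ E] (g : E → ℝ) (C : ℝ)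
    (h : ∀ x, ∃ p : E, ∀ h, ‖h‖ ≤ 1 → |g (x + h) - g x - inner ℝ p h| ≤ C * ‖h‖ ^ 2) :
    Continuous g := by
  rw [continuous_iff_continuousAt]
  intro x
  obtain ⟨p, hp⟩ := h x
  rw [ContinuousAt, tendsto_iff_norm_sub_tendsto_zero]
  have hlim : Filter.Tendsto (fun y => C * ‖y - x‖ ^ 2 + |inner ℝ p (y - x)|) (nhds x) (nhds 0) := by
    have : Continuous (fun y => C * ‖y - x‖ ^ 2 + |inner ℝ p (y - x)|) := by fun_prop
    simpa using this.tendsto x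
  refine squeeze_zero' (Filter.Eventually.of_forall fun _ => norm_nonneg _) ?_ hlim
  filter_upwards [closedBall_mem_nhds x one_pos] with y hy
  have := hp (y - x) (by simpa [dist_eq_norm] using hy)
  rw [add_sub_cancel] at this
  rw [Real.norm_eq_abs]
  calc |g y - g x| = |(g y - g x - inner ℝ p (y - x)) + inner ℝ p (y - x)| := by ring_nf
    _ ≤ _ := (abs_add_le _ _).trans (by linarith)

/-- existence of a good direction -/
theorem gfl_dir (hd : 1 ≤ d) (F : (Fin d → ℤ) → ℝ) (hF : ∀ v, F v = 0 ∨ F v = 1)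
    (φ : EuclideanSpace ℝ (Fin d) → ℝ) (h0 : ∀ y, 0 ≤ φ y) (h1 : ∫ y, φ y = 1) (hI : Integrable φ)
    (η : ℝ) (hη : η = 1 / (24 * d)) (hr : ∀ y, η / 2 < ‖y‖ → φ y = 0)
    (x : EuclideanSpace ℝ (Fin d)) (hx : gfl F φ x = 1 / 2) :
    ∃ u : EuclideanSpace ℝ (Fin d), ‖u‖ ≤ d ∧ ∃ σ : ℝ, |σ| = 1 ∧ ∃ t0 : ℝ, 0 < t0 ∧
      ∀ t, 0 ≤ t → t ≤ t0 → gfl F φ (x + t • u) = gfl F φ x + t * σ := by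
  have hdr : (1:ℝ) ≤ d := by exact_mod_cast hd
  have hη0 : 0 < η := by rw [hη]; positivity
  have hηd : 6 * d * η = 1 / 4 := by rw [hη]; field_simp; norm_num
  have hη1 : η < 1 := by nlinarith
  have hco : ∀ (y : EuclideanSpace ℝ (Fin d)) i, |y i| ≤ ‖y‖ := fun y i => by
    simpa using PiLp.norm_apply_le y i
  have ex : ∀ q : ℝ, (q = 0 ∨ q = 1) →
      ∃ t ∈ Ioo (0:ℝ) 1, t ∉ badT x η ∧ F (nfl x t) ≠ q := by
    intro q hq
    by_contra hcon
    push Not at hcon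
    have := gfl_avg F hF φ h0 h1 hI (η / 2) hr x q (1 / 4) (fun y hy => by
      rw [← hηd]
      refine ffl_near F hF x (x - y) η q hq hη1 hη0.le hcon fun i => ?_
      have := hco y i
      simp only [PiLp.sub_apply, sub_sub_cancel_left, abs_neg]
      linarith)
    rw [hx] at this
    rcases hq with rfl | rfl <;> norm_num [abs_le] at this
  obtain ⟨t1, ht1, hb1, hf1⟩ := ex 0 (Or.inl rfl)
  obtain ⟨t2, ht2, hb2, hf2⟩ := ex 1 (Or.inr rfl)
  replace hf1 : F (nfl x t1) = 1 := (hF _).resolve_left hf1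
  replace hf2 : F (nfl x t2) = 0 := (hF _).resolve_right hf2
  have main : ∀ b c, b ∈ Ioo (0:ℝ) 1 → c ∈ Ioo (0:ℝ) 1 → b ∉ badT x η → c ∉ badT x η → b < c →
      |F (nfl x c) - F (nfl x b)| = 1 → ∃ u : EuclideanSpace ℝ (Fin d), ‖u‖ ≤ d ∧ ∃ σ : ℝ, |σ| = 1 ∧ ∃ t0 : ℝ, 0 < t0 ∧
      ∀ t, 0 ≤ t → t ≤ t0 → gfl F φ (x + t • u) = gfl F φ x + t * σ := by
    intro b c hb hc hbT hcT hbc hσ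
    refine ⟨WithLp.toLp 2 (fun i => ((nfl x c i - nfl x b i : ℤ) : ℝ)), ?_,
      F (nfl x c) - F (nfl x b), hσ, min (η / 2) (min (c - b) (1 - c)), ?_, ?_⟩
    · have hu : ∀ i, ‖((nfl x c i - nfl x b i : ℤ) : ℝ)‖ ≤ 1 := by
        intro i
        have h1 : nfl x b i ≤ nfl x c i := Int.floor_le_floor (by linarith)
        have h2 : nfl x c i ≤ nfl x b i + 1 := by
          simp only [nfl]
          rw [← Int.floor_add_one]; exact Int.floor_le_floor (by linarith [hb.1, hc.2])
        rw [Real.norm_eq_abs, ← Int.cast_abs]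
        have : |nfl x c i - nfl x b i| ≤ 1 := by rw [abs_le]; omega
        exact_mod_cast this
      rw [EuclideanSpace.norm_eq, Real.sqrt_le_left (by positivity)]
      calc _ ≤ ∑ i : Fin d, (1:ℝ) := by
            apply Finset.sum_le_sum
            intro i _
            have := hu i
            have h0 := norm_nonneg ((nfl x c i - nfl x b i : ℤ) : ℝ)
            simp only
            nlinarith
        _ ≤ _ := by simp; nlinarith
    · refine lt_min (by positivity) (lt_min (by linarith) (by linarith [hc.2]))
    · intro t ht ht0
      have l1 := ht0.trans (min_le_left _ _)
      have l2 := (ht0.trans (min_le_right _ _)).trans (min_le_left _ _)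
      have l3 := (ht0.trans (min_le_right _ _)).trans (min_le_right _ _)
      set u : EuclideanSpace ℝ (Fin d) := WithLp.toLp 2 (fun i => ((nfl x c i - nfl x b i : ℤ) : ℝ)) with hu
      set σ := F (nfl x c) - F (nfl x b) with hσd
      have pt : ∀ y, ffl F (x + t • u - y) * φ y = ffl F (x - y) * φ y + t * σ * φ y := by
        intro y
        by_cases hy : ‖y‖ ≤ η / 2
        · have hfl : ∀ e, e ∈ Ioo (0:ℝ) 1 → e ∉ badT x η → ∀ τ ∈ Icc e (e + t),
              nfl (x - y) τ = nfl x e := by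
            intro e he heT τ hτ
            refine badT_floor x (x - y) η e τ hη1 he heT fun i => ?_
            have h1 := abs_le.1 ((hco y i).trans hy)
            simp only [PiLp.sub_apply]
            rw [abs_le]
            constructor <;> linarith [hτ.1, hτ.2]
          have := ffl_shift F hF (x - y) b c t (nfl x b) (nfl x c) hb.1.le ht (by linarith)
            (by linarith) (hfl b hb hbT) (hfl c hc hcT)
          rw [show x + t • u - y = x - y + t • u by abel, this]; ring
        · simp [hr y (not_le.1 hy)]
      rw [gfl_eq, gfl_eq]
      simp only [pt]
      rw [integral_add (by simpa using ffl_mul_int F hF φ hI x) (hI.const_mul _), integral_const_mul, h1, mul_one]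
  rcases lt_trichotomy t1 t2 with h | h | h
  · exact main t1 t2 ht1 ht2 hb1 hb2 h (by simp [hf1, hf2])
  · subst h; rw [hf1] at hf2; norm_num at hf2
  · exact main t2 t1 ht2 ht1 hb2 hb1 h (by simp [hf1, hf2])

theorem grad_lower {E : Type*} [NormedAddCommGroup E] [InnerProductSpace ℝ E] (g : E → ℝ) (C : ℝ)
    (x p u : E) (D σ t0 : ℝ) (hD : 0 < D) (hu : ‖u‖ ≤ D) (hσ : |σ| = 1) (ht0 : 0 < t0)
    (hp : ∀ h, ‖h‖ ≤ 1 → |g (x + h) - g x - inner ℝ p h| ≤ C * ‖h‖ ^ 2)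
    (hg : ∀ t, 0 ≤ t → t ≤ t0 → g (x + t • u) = g x + t * σ) : 1 / D ≤ ‖p‖ := by
  have key : ∀ t, 0 < t → t ≤ min t0 (1 / D) → |σ - inner ℝ p u| ≤ |C| * D ^ 2 * t := by
    intro t ht htt
    have hn : ‖t • u‖ ≤ t * D := by
      rw [norm_smul, Real.norm_of_nonneg ht.le]; gcongr
    have h1 := hp (t • u) (by
      have := htt.trans (min_le_right _ _)
      calc _ ≤ t * D := hn
        _ ≤ 1 / D * D := by gcongr
        _ = 1 := by field_simp)
    rw [hg t ht.le (htt.trans (min_le_left _ _)), inner_smul_right] at h1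
    have h2 : t * |σ - inner ℝ p u| ≤ t * (|C| * D ^ 2 * t) := by
      calc t * |σ - inner ℝ p u| = |g x + t * σ - g x - t * inner ℝ p u| := by
            rw [← abs_of_pos ht, ← abs_mul, abs_of_pos ht]; ring_nf
        _ ≤ C * ‖t • u‖ ^ 2 := h1
        _ ≤ |C| * (t * D) ^ 2 := by gcongr; exact le_abs_self C
        _ = _ := by ring
    exact le_of_mul_le_mul_left h2 ht
  have hzero : |σ - inner ℝ p u| ≤ 0 := by
    apply le_of_forall_pos_le_add
    intro ε hε
    have hK : 0 ≤ |C| * D ^ 2 := by positivity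
    have hpos : 0 < min (min t0 (1 / D)) (ε / (|C| * D ^ 2 + 1)) := by positivity
    refine (key _ hpos (min_le_left _ _)).trans ?_
    calc _ ≤ |C| * D ^ 2 * (ε / (|C| * D ^ 2 + 1)) := by gcongr; exact min_le_right _ _
      _ ≤ (|C| * D ^ 2 + 1) * (ε / (|C| * D ^ 2 + 1)) := by gcongr; linarith
      _ = 0 + ε := by field_simp; ring
  have hs : σ = inner ℝ p u := by
    have := abs_nonpos_iff.1 hzero; linarith
  rw [div_le_iff₀ hD]
  calc (1:ℝ) = |inner ℝ p u| := by rw [← hs, hσ]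
    _ ≤ ‖p‖ * ‖u‖ := abs_real_inner_le_norm p u
    _ ≤ _ := by gcongr

open Classical in
theorem unit_scale (d : ℕ) (hd : 1 ≤ d) : ∃ C : ℝ, 0 ≤ C ∧ ∀ A : Set (EuclideanSpace ℝ (Fin d)),
    ∃ g : EuclideanSpace ℝ (Fin d) → ℝ, Continuous g ∧ (∀ x ∈ A, 1 / 2 < g x) ∧
      (∀ x, 1 / 2 < g x → ∃ a ∈ A, dist x a ≤ 6 * d) ∧
      ∀ x, g x = 1 / 2 → ∃ p : EuclideanSpace ℝ (Fin d), 1 / (d : ℝ) ≤ ‖p‖ ∧ 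
        ∀ h, ‖h‖ ≤ 1 → |g (x + h) - g x - inner ℝ p h| ≤ C * ‖h‖ ^ 2 := by
  have hdr : (1:ℝ) ≤ d := by exact_mod_cast hd
  set η : ℝ := 1 / (24 * d) with hη
  have hη0 : 0 < η := by rw [hη]; positivity
  have hη1 : η ≤ 1 := by rw [hη, div_le_one (by positivity)]; linarith
  obtain ⟨φ, _, h0, h1, hI, hr, Dφ, L, hL, _, hDI, hT, hT0⟩ :=
    phi_exists d (η / 2) (by positivity) (by linarith)
  refine ⟨L * volume.real (closedBall (0 : EuclideanSpace ℝ (Fin d)) 2), by positivity, fun A => ?_⟩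
  let F : (Fin d → ℤ) → ℝ := fun v => if ∃ a ∈ A, ∀ i, |(v i : ℝ) - a i| ≤ 3 then 1 else 0
  have hF : ∀ v, F v = 0 ∨ F v = 1 := by
    intro v; simp only [F]; split_ifs <;> simp
  have htay := gfl_taylor F hF φ hI Dφ L hL hDI hT hT0
  have hco : ∀ (y : EuclideanSpace ℝ (Fin d)) i, |y i| ≤ ‖y‖ := fun y i => by
    simpa using PiLp.norm_apply_le y i
  have hnear : ∀ x y : EuclideanSpace ℝ (Fin d), ‖y‖ ≤ η / 2 → ∀ t ∈ Icc (0:ℝ) 1, ∀ i,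
      |(nfl (x - y) t i : ℝ) - x i| ≤ 3 := by
    intro x y hy t ht i
    have h1 := abs_le.1 ((hco y i).trans hy)
    have f1 := Int.floor_le ((x - y) i + t)
    have f2 := Int.lt_floor_add_one ((x - y) i + t)
    simp only [nfl]
    rw [abs_le]
    simp only [PiLp.sub_apply] at *
    constructor <;> linarith [ht.1, ht.2]
  refine ⟨gfl F φ, taylor_cont _ _ htay, ?_, ?_, ?_⟩
  · intro x hx
    have := gfl_avg F hF φ h0 h1 hI (η / 2) hr x 1 0 (fun y hy => by
      rw [ffl_const F (x - y) 1]
      · simp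
      · intro t ht
        exact if_pos ⟨x, hx, hnear x y hy t ht⟩)
    have := abs_nonpos_iff.1 this
    linarith
  · intro x hx
    by_contra hcon
    push Not at hcon
    have := gfl_avg F hF φ h0 h1 hI (η / 2) hr x 0 0 (fun y hy => by
      rw [ffl_const F (x - y) 0]
      · simp
      · intro t ht
        refine if_neg ?_
        rintro ⟨a, ha, hva⟩
        refine absurd (hcon a ha) (not_lt.2 ?_)
        rw [dist_eq_norm, EuclideanSpace.norm_eq, Real.sqrt_le_left (by positivity)]
        calc _ ≤ ∑ i : Fin d, (36:ℝ) := by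
              apply Finset.sum_le_sum
              intro i _
              have q1 := abs_le.1 (hva i)
              have q2 := abs_le.1 (hnear x y hy t ht i)
              rw [Real.norm_eq_abs, sq_abs, PiLp.sub_apply]
              nlinarith
          _ ≤ _ := by simp; nlinarith)
    have := abs_nonpos_iff.1 this
    linarith
  · intro x hx
    obtain ⟨p, hp⟩ := htay x
    obtain ⟨u, hu, σ, hσ, t0, ht0, hg⟩ := gfl_dir hd F hF φ h0 h1 hI η hη hr x hx
    exact ⟨p, grad_lower _ _ x p u d σ t0 (by linarith) hu hσ ht0 hp hg, hp⟩

theorem sreg_of_level (g : EuclideanSpace ℝ (Fin d) → ℝ) (hg : Continuous g) (m a C ρ : ℝ)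
    (hρ : 0 < ρ) (hρa : 2 * ρ ≤ a) (hC : 0 ≤ C) (hCm : C * (2 * ρ) < m)
    (h : ∀ x, g x = 1 / 2 → ∃ p : EuclideanSpace ℝ (Fin d), m ≤ ‖p‖ ∧
      ∀ h, ‖h‖ ≤ a → |g (x + h) - g x - inner ℝ p h| ≤ C * ‖h‖ ^ 2) :
    SReg d ρ {x | 1 / 2 < g x} := by
  have hopen : IsOpen {x | 1 / 2 < g x} := isOpen_lt continuous_const hg
  have hfr : ∀ y ∈ frontier {x | 1 / 2 < g x}, g y = 1 / 2 := fun y hy =>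
    (frontier_lt_subset_eq continuous_const hg hy).symm
  refine ⟨hopen, fun x hx => ?_⟩
  have hgx := hfr x hx
  obtain ⟨p, hp, hT⟩ := h x hgx
  have hp0 : 0 < ‖p‖ := lt_of_lt_of_le (lt_of_le_of_lt (by positivity) hCm) hp
  have t1 := sreg_touch g x p m a C ρ hp hρ hρa hC hCm hT
  have t2 := sreg_touch (fun y => - g y) x (-p) m a C ρ (by simpa using hp) hρ hρa hC hCm (by
    intro h hh
    have := hT h hh
    rw [← abs_neg] at this
    rw [inner_neg_left]
    convert this using 2; ring)
  have hmem : ∀ q : EuclideanSpace ℝ (Fin d), ‖q‖ = ‖p‖ → x ∈ closedBall (x + (ρ / ‖q‖) • q) ρ := by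
    intro q hq
    rw [mem_closedBall, dist_eq_norm, sub_add_cancel_left, norm_neg, norm_smul,
      Real.norm_of_nonneg (by positivity), hq]
    apply le_of_eq; field_simp
  refine ⟨x + (ρ / ‖p‖) • p, x + (ρ / ‖-p‖) • (-p), ?_, ?_, ?_, ?_⟩
  · intro y hy
    by_cases hyx : y = x
    · rw [hyx]; exact frontier_subset_closure hx
    · apply subset_closure
      have := t1 y hy hyx
      simp only [mem_setOf_eq]; linarith
  · intro y hy
    simp only [mem_compl_iff, mem_setOf_eq, not_lt]
    by_cases hyx : y = x
    · rw [hyx, hgx]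
    · have := t2 y hy hyx
      linarith
  · ext y
    simp only [mem_inter_iff, mem_singleton_iff]
    constructor
    · rintro ⟨hy1, hy2⟩
      by_contra hyx
      have := t1 y hy2 hyx
      linarith [hfr y hy1]
    · rintro rfl
      exact ⟨hx, hmem p rfl⟩
  · ext y
    simp only [mem_inter_iff, mem_singleton_iff]
    constructor
    · rintro ⟨hy1, hy2⟩
      by_contra hyx
      have := t2 y hy2 hyx
      linarith [hfr y hy1]
    · rintro rfl
      exact ⟨hx, hmem (-p) (norm_neg p)⟩

/-- **Smoothening of subsets of `ℝ^d`** (Lemma 6.2 of Popov–Teixeira, "Soft local times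
and decoupling of random interlacements"). -/
theorem stmt_10 (d : ℕ) (hd : 1 ≤ d) :
    ∃ c : ℝ, 0 < c ∧ c < 1 / 5 ∧
      ∀ A : Set (EuclideanSpace ℝ (Fin d)), ∀ s : ℝ, 0 < s →
        ∃ A' : Set (EuclideanSpace ℝ (Fin d)),
          A ⊆ A' ∧ A' ⊆ (⋃ x ∈ A, closedBall x (s / 5)) ∧ SReg d (c * s) A' := by
  have hdr : (1:ℝ) ≤ d := by exact_mod_cast hd
  obtain ⟨C, hC, H⟩ := unit_scale d hd
  have hdC : 0 ≤ d * C := by positivity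
  refine ⟨1 / (60 * d * (1 + d * C)), by positivity, ?_, fun A s hs => ?_⟩
  · rw [div_lt_div_iff₀ (by positivity) (by norm_num)]
    nlinarith
  set a : ℝ := s / (30 * d) with ha
  have ha0 : 0 < a := by positivity
  obtain ⟨g, hg, hgA, hgB, hgT⟩ := H {y | a • y ∈ A}
  have hρ : 2 * (1 / (60 * d * (1 + d * C)) * s) = a / (1 + d * C) := by
    rw [ha]; field_simp; norm_num
  refine ⟨{x | 1 / 2 < g (a⁻¹ • x)}, ?_, ?_, ?_⟩
  · intro x hx
    exact hgA _ (by simpa [smul_smul, ha0.ne'] using hx)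
  · intro x hx
    obtain ⟨b, hb, hxb⟩ := hgB _ hx
    refine mem_biUnion hb ?_
    rw [mem_closedBall]
    have : x = a • (a⁻¹ • x) := by simp [smul_smul, ha0.ne']
    rw [this, dist_smul₀, Real.norm_of_nonneg ha0.le]
    calc _ ≤ a * (6 * d) := by gcongr
      _ = s / 5 := by rw [ha]; field_simp; norm_num
  · refine sreg_of_level (fun x => g (a⁻¹ • x)) (hg.comp (by fun_prop)) (a⁻¹ * (1 / d)) a (C * (a⁻¹) ^ 2) _
      (by positivity) ?_ (by positivity) ?_ ?_
    · rw [hρ, div_le_iff₀ (by positivity)]; nlinarith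
    · rw [hρ]
      have : C / (1 + d * C) < 1 / d := by
        rw [div_lt_div_iff₀ (by positivity) (by positivity)]; linarith
      calc C * a⁻¹ ^ 2 * (a / (1 + d * C)) = a⁻¹ * (C / (1 + d * C)) := by field_simp
        _ < _ := by gcongr
    · intro x hx
      obtain ⟨p, hp, hT⟩ := hgT _ hx
      refine ⟨a⁻¹ • p, ?_, fun h hh => ?_⟩
      · rw [norm_smul, Real.norm_of_nonneg (by positivity)]; gcongr
      · have hn : ‖a⁻¹ • h‖ = a⁻¹ * ‖h‖ := by
          rw [norm_smul, Real.norm_of_nonneg (by positivity)]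
        have := hT (a⁻¹ • h) (by rw [hn, inv_mul_le_iff₀ ha0]; simpa using hh)
        rw [hn, ← smul_add, inner_smul_right] at this
        rw [inner_smul_left]
        simp only [conj_trivial]
        refine this.trans (le_of_eq (by ring))
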